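/- arXiv:1807.07035 — 2 statements merged into one kernel-verified Lean document; each statement's English description precedes it below -/
import Mathlib

section
/- Let Γ ⊂ ℝⁿ be d-dimensional Ahlfors regular (possibly of fractional dimension) with σ a measure satisfying the AR condition, and suppose n = d + 2 + α with α > 0. Define D_α(X) = (∫_Γ |X−y|^{−d−α} dσ(y))^{−1/α} on Ω = ℝⁿ \ Γ. Then D_α is smooth on Ω and satisfies div(D_α^{d+1−n} ∇ D_α) = 0 pointwise in Ω; i.e., D_α is a solution of L_α D_α = 0 for L_α = −div(D_α^{d+1−n} ∇). -/
open MeasureTheory Metric Set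
open scoped ENNReal

/-- Divergence of a vector field on Euclidean space: trace of the derivative. -/
noncomputable def vecDiv {n : ℕ} (V : EuclideanSpace ℝ (Fin n) → EuclideanSpace ℝ (Fin n))
    (X : EuclideanSpace ℝ (Fin n)) : ℝ :=
  ∑ i : Fin n, fderiv ℝ V X (EuclideanSpace.single i 1) i

open Filter Topology 

section helpers

variable {n : ℕ} {F : Type} [NormedAddCommGroup F] [NormedSpace ℝ F]

def HomDeg (s : ℝ) (g : EuclideanSpace ℝ (Fin n) → F) : Prop :=
  ContDiffOn ℝ (⊤ : ℕ∞) g {0}ᶜ ∧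
    ∀ t : ℝ, 0 < t → ∀ x, x ≠ 0 → g (t • x) = t ^ (-s) • g x

theorem HomDeg.bound {s : ℝ} {g : EuclideanSpace ℝ (Fin n) → F} (h : HomDeg s g) :
    ∃ C : ℝ, 0 ≤ C ∧ ∀ x, x ≠ 0 → ‖g x‖ ≤ C * ‖x‖ ^ (-s) := by
  have hK : IsCompact (sphere (0 : EuclideanSpace ℝ (Fin n)) 1) := isCompact_sphere 0 1
  have hc : ContinuousOn g (sphere (0 : EuclideanSpace ℝ (Fin n)) 1) := by
    refine h.1.continuousOn.mono fun x hx => ?_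
    simp only [mem_sphere_iff_norm, sub_zero] at hx
    simp only [mem_compl_iff, mem_singleton_iff]
    rintro rfl
    simp at hx
  obtain ⟨C, hC⟩ := hK.exists_bound_of_continuousOn hc
  refine ⟨max C 0, le_max_right _ _, fun x hx => ?_⟩
  have hp : 0 < ‖x‖ := norm_pos_iff.2 hx
  have hu : ‖(‖x‖⁻¹ • x)‖ = 1 := by
    rw [norm_smul (‖x‖⁻¹) x, norm_inv, norm_norm, inv_mul_cancel₀ hp.ne']
  have h1 := h.2 ‖x‖ hp (‖x‖⁻¹ • x) (by rw [← norm_pos_iff, hu]; norm_num)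
  rw [smul_smul, mul_inv_cancel₀ hp.ne', one_smul] at h1
  rw [h1, norm_smul, Real.norm_of_nonneg (by positivity), mul_comm]
  gcongr
  exact (hC _ (by simpa using hu)).trans (le_max_left _ _)

theorem HomDeg.fderivHom {s : ℝ} {g : EuclideanSpace ℝ (Fin n) → F} (h : HomDeg s g) :
    HomDeg (s + 1) (fderiv ℝ g) := by
  refine ⟨h.1.fderiv_of_isOpen isOpen_compl_singleton (by simp), fun t ht x hx => ?_⟩
  have he : (fun y => g (t • y)) =ᶠ[𝓝 x] fun y => t ^ (-s) • g y := by
    filter_upwards [isOpen_compl_singleton.mem_nhds (show x ∈ ({0}ᶜ : Set _) from hx)] with y hy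
    exact h.2 t ht y hy
  have h1 := he.fderiv_eq (𝕜 := ℝ)
  rw [fderiv_comp_smul, fderiv_fun_const_smul] at h1
  · have h2 : t ^ (-(s + 1)) = t⁻¹ * t ^ (-s) := by
      rw [neg_add, Real.rpow_add ht, Real.rpow_neg_one, mul_comm]
    rw [h2, mul_smul, ← h1, smul_smul, inv_mul_cancel₀ ht.ne', one_smul]
  · exact (h.1.differentiableOn (by simp)).differentiableAt
      (isOpen_compl_singleton.mem_nhds hx)

variable {σ : Measure (EuclideanSpace ℝ (Fin n))} {Γ : Set (EuclideanSpace ℝ (Fin n))}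

theorem HomDeg.meas {s : ℝ} {g : EuclideanSpace ℝ (Fin n) → F} (h : HomDeg s g)
    (hclosed : IsClosed Γ) (hnull : σ Γᶜ = 0) {X : EuclideanSpace ℝ (Fin n)} (hX : X ∉ Γ) :
    AEStronglyMeasurable (fun y => g (X - y)) σ := by
  have hr : σ.restrict Γ = σ := Measure.restrict_eq_self_of_ae_mem hnull
  rw [← hr]
  refine ContinuousOn.aestronglyMeasurable ?_ hclosed.measurableSet
  refine h.1.continuousOn.comp (by fun_prop) fun y hy => ?_
  simp only [mem_compl_iff, mem_singleton_iff, sub_eq_zero]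
  rintro rfl
  exact hX hy

theorem HomDeg.integrable {s : ℝ} {g : EuclideanSpace ℝ (Fin n) → F} (h : HomDeg s g)
    (hclosed : IsClosed Γ) (hnull : σ Γᶜ = 0) {X : EuclideanSpace ℝ (Fin n)} (hX : X ∉ Γ)
    (hI : Integrable (fun y => ‖X - y‖ ^ (-s)) σ) :
    Integrable (fun y => g (X - y)) σ := by
  obtain ⟨C, -, hC⟩ := h.bound
  refine (hI.const_mul C).mono' (h.meas hclosed hnull hX) ?_
  have : ∀ᵐ y ∂σ, y ∈ Γ := hnull
  filter_upwards [this] with y hy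
  refine hC _ (sub_ne_zero.2 ?_)
  rintro rfl
  exact hX hy

theorem HomDeg.hasFDerivAt {s : ℝ} (hs : 0 ≤ s) {g : EuclideanSpace ℝ (Fin n) → F}
    (h : HomDeg s g)
    (hclosed : IsClosed Γ) (hnull : σ Γᶜ = 0) {X : EuclideanSpace ℝ (Fin n)} (hX : X ∉ Γ)
    (hI : Integrable (fun y => ‖X - y‖ ^ (-s)) σ)
    (hI' : Integrable (fun y => ‖X - y‖ ^ (-(s + 1))) σ) :
    HasFDerivAt (fun Z => ∫ y, g (Z - y) ∂σ) (∫ y, fderiv ℝ g (X - y) ∂σ) X := by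
  obtain ⟨C, hC0, hC⟩ := h.fderivHom.bound
  obtain ⟨δ, hδ, hball⟩ := Metric.isOpen_iff.1 hclosed.isOpen_compl X hX
  have hae : ∀ᵐ y ∂σ, y ∈ Γ := hnull
  have key : ∀ y ∈ Γ, ∀ Z ∈ ball X (δ / 2), Z - y ≠ 0 ∧ ‖X - y‖ / 2 ≤ ‖Z - y‖ ∧ 0 < ‖X - y‖ := by
    intro y hy Z hZ
    have h1 : δ ≤ ‖X - y‖ := by
      by_contra hlt
      refine hball (a := y) ?_ hy
      rw [mem_ball, dist_comm, dist_eq_norm]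
      exact not_le.1 hlt
    have h2 : ‖X - Z‖ < δ / 2 := by rwa [mem_ball, dist_comm, dist_eq_norm] at hZ
    have h3 : ‖X - y‖ ≤ ‖X - Z‖ + ‖Z - y‖ := norm_sub_le_norm_sub_add_norm_sub _ _ _
    have h4 : ‖X - y‖ / 2 ≤ ‖Z - y‖ := by linarith
    refine ⟨?_, h4, by linarith⟩
    rw [← norm_pos_iff]; linarith
  refine hasFDerivAt_integral_of_dominated_of_fderiv_le
    (F := fun Z y => g (Z - y)) (F' := fun Z y => fderiv ℝ g (Z - y))
    (bound := fun y => C * ((2⁻¹ : ℝ) ^ (-(s + 1)) * ‖X - y‖ ^ (-(s + 1))))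
    (ball_mem_nhds X (half_pos hδ)) ?_ (h.integrable hclosed hnull hX hI)
    (h.fderivHom.meas hclosed hnull hX) ?_ ((hI'.const_mul _).const_mul _) ?_
  · filter_upwards [hclosed.isOpen_compl.mem_nhds hX] with Z hZ
    exact h.meas hclosed hnull hZ
  · filter_upwards [hae] with y hy Z hZ
    obtain ⟨h1, h2, h3⟩ := key y hy Z hZ
    refine (hC _ h1).trans ?_
    gcongr
    rw [← Real.mul_rpow (by norm_num) h3.le]
    exact Real.rpow_le_rpow_of_nonpos (by positivity) (by linarith) (by linarith)
  · filter_upwards [hae] with y hy Z hZ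
    obtain ⟨h1, h2, h3⟩ := key y hy Z hZ
    have hd : DifferentiableAt ℝ g (Z - y) := (h.1.differentiableOn (by simp)).differentiableAt
      (isOpen_compl_singleton.mem_nhds h1)
    exact (hasFDerivAt_comp_sub y).2 hd.hasFDerivAt

end helpers

theorem HomDeg.contDiffOn {n : ℕ}
    {σ : Measure (EuclideanSpace ℝ (Fin n))} {Γ : Set (EuclideanSpace ℝ (Fin n))}
    (hclosed : IsClosed Γ) (hnull : σ Γᶜ = 0) {s₀ : ℝ} (hs₀ : 0 ≤ s₀)
    (hI : ∀ s, s₀ ≤ s → ∀ X ∉ Γ, Integrable (fun y => ‖X - y‖ ^ (-s)) σ) (m : ℕ) :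
    ∀ (F : Type) [NormedAddCommGroup F] [NormedSpace ℝ F]
      (g : EuclideanSpace ℝ (Fin n) → F) (s : ℝ), s₀ ≤ s → HomDeg s g →
      ContDiffOn ℝ m (fun Z => ∫ y, g (Z - y) ∂σ) Γᶜ := by
  induction m with
  | zero =>
    intro F _ _ g s hs h
    simp only [CharP.cast_eq_zero, contDiffOn_zero]
    intro X hX
    exact (h.hasFDerivAt (hs₀.trans hs) hclosed hnull hX (hI s hs X hX)
      (hI _ (by linarith) X hX)).continuousAt.continuousWithinAt
  | succ m ih =>
    intro F _ _ g s hs h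
    have hd := fun X (hX : X ∈ Γᶜ) => h.hasFDerivAt (hs₀.trans hs) hclosed hnull hX (hI s hs X hX)
      (hI _ (by linarith) X hX)
    push_cast
    rw [contDiffOn_succ_iff_fderiv_of_isOpen hclosed.isOpen_compl]
    refine ⟨fun X hX => (hd X hX).differentiableAt.differentiableWithinAt, by simp, ?_⟩
    exact (ih _ (fderiv ℝ g) (s + 1) (by linarith) h.fderivHom).congr fun X hX => (hd X hX).fderiv

theorem integrable_kernel {n : ℕ} {d C₀ : ℝ} (hd₀ : 0 ≤ d) (hC₀ : 0 < C₀)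
    {σ : Measure (EuclideanSpace ℝ (Fin n))} {Γ : Set (EuclideanSpace ℝ (Fin n))}
    (hclosed : IsClosed Γ) (hnull : σ Γᶜ = 0)
    (hAR : ∀ x ∈ Γ, ∀ r : ℝ, 0 < r → σ (ball x r) ≤ ENNReal.ofReal (C₀ * r ^ d))
    (s : ℝ) (hs : d < s) (X : EuclideanSpace ℝ (Fin n)) (hX : X ∉ Γ) :
    Integrable (fun y => ‖X - y‖ ^ (-s)) σ := by
  obtain ⟨δ, hδ, hball⟩ := Metric.isOpen_iff.1 hclosed.isOpen_compl X hX
  have hae : ∀ᵐ y ∂σ, y ∈ Γ := hnull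
  have hfar : ∀ y ∈ Γ, δ ≤ ‖X - y‖ := by
    intro y hy
    by_contra hlt
    refine hball (a := y) ?_ hy
    rw [mem_ball, dist_comm, dist_eq_norm]
    exact not_le.1 hlt
  have hb : ∀ R : ℝ, 0 < R → σ (ball X R) ≤ ENNReal.ofReal (C₀ * (2 * R) ^ d) := by
    intro R hR
    by_cases hne : ∃ z ∈ Γ, z ∈ ball X R
    · obtain ⟨z, hz, hzR⟩ := hne
      refine (measure_mono ?_).trans (hAR z hz (2 * R) (by linarith))
      intro w hw
      rw [mem_ball] at *
      have := dist_triangle_right w z X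
      linarith
    · push Not at hne
      have : σ (ball X R) = 0 := measure_mono_null (fun w hw hw' => hne w hw' hw) hnull
      rw [this]; exact zero_le
  let A : ℕ → Set (EuclideanSpace ℝ (Fin n)) := fun k =>
    {y | 2 ^ k * δ ≤ ‖X - y‖} ∩ ball X (2 ^ (k + 1) * δ)
  have hcov : Γ ⊆ ⋃ k, A k := by
    intro y hy
    have h1 : 1 ≤ ‖X - y‖ / δ := by rw [le_div_iff₀ hδ, one_mul]; exact hfar y hy
    obtain ⟨k, hk1, hk2⟩ := exists_nat_pow_near h1 (by norm_num : (1 : ℝ) < 2)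
    rw [le_div_iff₀ hδ] at hk1
    rw [div_lt_iff₀ hδ] at hk2
    refine mem_iUnion.2 ⟨k, hk1, ?_⟩
    rw [mem_ball, dist_comm, dist_eq_norm]; exact hk2
  have hmeas : AEStronglyMeasurable (fun y => ‖X - y‖ ^ (-s)) σ := by
    apply Measurable.aestronglyMeasurable
    fun_prop
  refine ⟨hmeas, ?_⟩
  rw [hasFiniteIntegral_iff_ofReal (Eventually.of_forall fun y => by positivity)]
  have hr : σ.restrict Γ = σ := Measure.restrict_eq_self_of_ae_mem hnull
  let q : ℝ := 2 ^ (d - s)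
  let K : ℝ := δ ^ (-s) * (C₀ * (4 * δ) ^ d)
  have hq0 : 0 ≤ q := by positivity
  have hq1 : q < 1 := Real.rpow_lt_one_of_one_lt_of_neg (by norm_num) (by linarith)
  have hpiece : ∀ k, ∫⁻ y in A k, ENNReal.ofReal (‖X - y‖ ^ (-s)) ∂σ
      ≤ ENNReal.ofReal (K * q ^ k) := by
    intro k
    have hm : MeasurableSet (A k) := by
      refine MeasurableSet.inter ?_ measurableSet_ball
      exact measurableSet_le measurable_const (by fun_prop)
    calc ∫⁻ y in A k, ENNReal.ofReal (‖X - y‖ ^ (-s)) ∂σ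
        ≤ ∫⁻ y in A k, ENNReal.ofReal ((2 ^ k * δ) ^ (-s)) ∂σ := by
          refine setLIntegral_mono measurable_const fun y hy => ?_
          apply ENNReal.ofReal_le_ofReal
          exact Real.rpow_le_rpow_of_nonpos (by positivity) hy.1 (by linarith)
      _ = ENNReal.ofReal ((2 ^ k * δ) ^ (-s)) * σ (A k) := by rw [setLIntegral_const]
      _ ≤ ENNReal.ofReal ((2 ^ k * δ) ^ (-s)) *
            ENNReal.ofReal (C₀ * (2 * (2 ^ (k + 1) * δ)) ^ d) := by
          gcongr
          exact (measure_mono inter_subset_right).trans (hb _ (by positivity))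
      _ = ENNReal.ofReal (K * q ^ k) := by
          rw [← ENNReal.ofReal_mul (by positivity)]
          congr 1
          have e1 : (2 * (2 ^ (k + 1) * δ) : ℝ) = 2 ^ k * (4 * δ) := by ring
          rw [e1, Real.mul_rpow (by positivity) (by positivity),
            Real.mul_rpow (x := 2 ^ k) (by positivity) (by positivity)]
          have e2 : q ^ k = ((2 : ℝ) ^ k) ^ d * ((2 : ℝ) ^ k) ^ (-s) := by
            rw [← Real.rpow_add (by positivity), ← Real.rpow_natCast, ← Real.rpow_natCast,
              ← Real.rpow_mul (by norm_num), ← Real.rpow_mul (by norm_num)]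
            ring_nf
          rw [e2]
          ring
  calc ∫⁻ y, ENNReal.ofReal (‖X - y‖ ^ (-s)) ∂σ
      = ∫⁻ y in Γ, ENNReal.ofReal (‖X - y‖ ^ (-s)) ∂σ := by rw [hr]
    _ ≤ ∫⁻ y in ⋃ k, A k, ENNReal.ofReal (‖X - y‖ ^ (-s)) ∂σ := lintegral_mono_set hcov
    _ ≤ ∑' k, ∫⁻ y in A k, ENNReal.ofReal (‖X - y‖ ^ (-s)) ∂σ := lintegral_iUnion_le _ _
    _ ≤ ∑' k, ENNReal.ofReal (K * q ^ k) := ENNReal.tsum_le_tsum hpiece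
    _ < ∞ := by
        rw [← ENNReal.ofReal_tsum_of_nonneg (fun k => by positivity)
          ((summable_geometric_of_lt_one hq0 hq1).mul_left K)]
        exact ENNReal.ofReal_lt_top

theorem kernel_contDiffOn {n : ℕ} (s : ℝ) :
    ContDiffOn ℝ (⊤ : ℕ∞) (fun x : EuclideanSpace ℝ (Fin n) => ‖x‖ ^ (-s)) {0}ᶜ := by
  intro x hx
  exact ((contDiffAt_norm ℝ hx).rpow_const_of_ne (norm_ne_zero_iff.2 hx)).contDiffWithinAt

theorem kernel_homDeg {n : ℕ} (s : ℝ) :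
    HomDeg s (fun x : EuclideanSpace ℝ (Fin n) => ‖x‖ ^ (-s)) := by
  refine ⟨kernel_contDiffOn s, fun t ht x hx => ?_⟩
  simp only
  rw [norm_smul, Real.norm_of_nonneg ht.le, Real.mul_rpow ht.le (norm_nonneg _), smul_eq_mul]

theorem sq_kernel_hasFDerivAt {n : ℕ} (p : ℝ) (x : EuclideanSpace ℝ (Fin n)) (hx : x ≠ 0) :
    HasFDerivAt (fun x : EuclideanSpace ℝ (Fin n) => (‖x‖ ^ 2) ^ p)
      ((2 * p * (‖x‖ ^ 2) ^ (p - 1)) • innerSL ℝ x) x := by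
  have h1 := (hasStrictFDerivAt_norm_sq x).hasFDerivAt
  have h2 := h1.rpow_const (p := p) (Or.inl (by positivity))
  refine h2.congr_fderiv (ContinuousLinearMap.ext fun v => Eq.symm ?_)
  change 2 * p * (‖x‖ ^ 2) ^ (p - 1) * inner ℝ x v
    = p * (‖x‖ ^ 2) ^ (p - 1) * ((2 : ℕ) • inner ℝ x v)
  simp only [nsmul_eq_mul, Nat.cast_ofNat]
  ring

theorem kernel_eq {n : ℕ} (s : ℝ) :
    (fun x : EuclideanSpace ℝ (Fin n) => ‖x‖ ^ (-s)) = fun x => (‖x‖ ^ 2) ^ (-s / 2) := by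
  ext x
  rw [← Real.rpow_natCast, ← Real.rpow_mul (norm_nonneg _)]
  congr 1
  push_cast
  ring

theorem kernel_laplacian {n : ℕ} (s : ℝ) (hs : s = n - 2) (x : EuclideanSpace ℝ (Fin n))
    (hx : x ≠ 0) :
    ∑ i : Fin n, fderiv ℝ (fderiv ℝ (fun x : EuclideanSpace ℝ (Fin n) => ‖x‖ ^ (-s))) x
      (EuclideanSpace.single i 1) (EuclideanSpace.single i 1) = 0 := by
  rw [kernel_eq]
  set p : ℝ := -s / 2 with hp
  have he : fderiv ℝ (fun x : EuclideanSpace ℝ (Fin n) => (‖x‖ ^ 2) ^ p) =ᶠ[𝓝 x]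
      fun x => (2 * p * (‖x‖ ^ 2) ^ (p - 1)) • innerSL ℝ x := by
    filter_upwards [isOpen_compl_singleton.mem_nhds (show x ∈ ({0}ᶜ : Set _) from hx)] with y hy
    exact (sq_kernel_hasFDerivAt p y hy).fderiv
  rw [he.fderiv_eq]
  have h1 := ((sq_kernel_hasFDerivAt (p - 1) x hx).const_mul (2 * p)).smul
    (innerSL (E := EuclideanSpace ℝ (Fin n)) ℝ).hasFDerivAt
  have h1' : fderiv ℝ (fun x : EuclideanSpace ℝ (Fin n) =>
      (2 * p * (‖x‖ ^ 2) ^ (p - 1)) • innerSL ℝ x) x = _ := h1.fderiv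
  rw [h1']
  have hpos : 0 < ‖x‖ ^ 2 := by positivity
  have e1 : (‖x‖ ^ 2) ^ (p - 1) = (‖x‖ ^ 2) ^ (p - 1 - 1) * ‖x‖ ^ 2 := by
    rw [Real.rpow_sub_one hpos.ne' (p - 1)]
    field_simp
  have e2 : ‖x‖ ^ 2 = ∑ i, x i ^ 2 := by
    rw [EuclideanSpace.real_norm_sq_eq]
  trans ∑ i : Fin n, 2 * p * (‖x‖ ^ 2) ^ (p - 1 - 1) * (‖x‖ ^ 2 + 2 * (p - 1) * x i ^ 2)
  · refine Finset.sum_congr rfl fun i _ => ?_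
    change 2 * p * (‖x‖ ^ 2) ^ (p - 1) * inner ℝ (EuclideanSpace.single i (1 : ℝ))
        (EuclideanSpace.single i (1 : ℝ)) + 2 * p * (2 * (p - 1) * (‖x‖ ^ 2) ^ (p - 1 - 1) *
        inner ℝ x (EuclideanSpace.single i (1 : ℝ))) * inner ℝ x (EuclideanSpace.single i (1 : ℝ)) = _
    simp only [EuclideanSpace.inner_single_right]
    simp
    rw [e1]; ring
  · rw [← Finset.mul_sum, Finset.sum_add_distrib, ← Finset.mul_sum, ← e2]
    simp
    right
    rw [hp, hs]; ring

/-- If Γ is d-AR (possibly of fractional dimension), n = d + 2 + α with α > 0,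
and D_α(X) = (∫_Γ |X-y|^{-d-α} dσ(y))^{-1/α}, then D_α is smooth on Ω = ℝⁿ \ Γ and
div(D_α^{d+1-n} ∇D_α) = 0 pointwise in Ω, i.e. L_α D_α = 0. -/
theorem regularized_distance_is_solution
    (n : ℕ) (d C₀ α : ℝ) (hd₀ : 0 ≤ d) (hα : 0 < α) (hC₀ : 0 < C₀)
    (hn : (n : ℝ) = d + 2 + α)
    (σ : Measure (EuclideanSpace ℝ (Fin n)))
    (Γ : Set (EuclideanSpace ℝ (Fin n)))
    (hclosed : IsClosed Γ) (hnull : σ Γᶜ = 0)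
    (hAR : ∀ x ∈ Γ, ∀ r : ℝ, 0 < r →
      ENNReal.ofReal (C₀⁻¹ * r ^ d) ≤ σ (ball x r) ∧
      σ (ball x r) ≤ ENNReal.ofReal (C₀ * r ^ d))
    (D : EuclideanSpace ℝ (Fin n) → ℝ)
    (hD : ∀ X ∉ Γ,
      D X = (((∫⁻ y, ENNReal.ofReal (dist X y ^ (-(d + α))) ∂σ)) ^ (-(1 / α))).toReal) :
    ContDiffOn ℝ (⊤ : ℕ∞) D Γᶜ ∧
      ∀ X ∉ Γ,
        vecDiv (fun Y => D Y ^ (d + 1 - (n : ℝ)) • gradient D Y) X = 0 := by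
  set s : ℝ := d + α with hsdef
  rcases Γ.eq_empty_or_nonempty with hE | hne
  · subst hE
    have hσ : σ = 0 := by simpa using hnull
    have hD0 : D = fun _ => 0 := by
      ext X
      rw [hD X (by simp), hσ, lintegral_zero_measure, ENNReal.zero_rpow_of_neg (by
        have : 0 < 1 / α := by positivity
        linarith)]
      simp
    subst hD0
    refine ⟨contDiffOn_const, fun X _ => ?_⟩
    have : (fun Y : EuclideanSpace ℝ (Fin n) =>
        (0 : ℝ) ^ (d + 1 - (n : ℝ)) • gradient (fun _ : EuclideanSpace ℝ (Fin n) => (0 : ℝ)) Y)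
        = fun _ => 0 := by
      ext Y
      simp [gradient]
    simp [vecDiv]
  have hint : ∀ s', s ≤ s' → ∀ X ∉ Γ, Integrable (fun y => ‖X - y‖ ^ (-s')) σ :=
    fun s' hs' X hX => integrable_kernel hd₀ hC₀ hclosed hnull (fun x hx r hr => (hAR x hx r hr).2)
      s' (by linarith) X hX
  have hs0 : 0 ≤ s := by linarith
  let g : EuclideanSpace ℝ (Fin n) → ℝ := fun x => ‖x‖ ^ (-s)
  have hg : HomDeg s g := kernel_homDeg s
  let I : EuclideanSpace ℝ (Fin n) → ℝ := fun Z => ∫ y, g (Z - y) ∂σ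
  have hIc : ContDiffOn ℝ (⊤ : ℕ∞) I Γᶜ := contDiffOn_infty.2 fun m =>
    HomDeg.contDiffOn hclosed hnull hs0 hint m ℝ g s le_rfl hg
  have hae : ∀ᵐ y ∂σ, y ∈ Γ := hnull
  have hσ0 : σ ≠ 0 := by
    rintro rfl
    obtain ⟨x, hx⟩ := hne
    have := (hAR x hx 1 one_pos).1
    simp at this
    linarith
  have hIeq : ∀ X ∉ Γ, ∫⁻ y, ENNReal.ofReal (dist X y ^ (-s)) ∂σ = ENNReal.ofReal (I X) := by
    intro X hX
    rw [ofReal_integral_eq_lintegral_ofReal (hint s le_rfl X hX)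
      (Eventually.of_forall fun y => by positivity)]
    simp only [dist_eq_norm]
  have hIpos : ∀ X ∉ Γ, 0 < I X := by
    intro X hX
    rw [← ENNReal.ofReal_pos, ← hIeq X hX, pos_iff_ne_zero]
    intro h0
    rw [lintegral_eq_zero_iff (by fun_prop)] at h0
    apply hσ0
    rw [← ae_eq_bot, ← Filter.empty_mem_iff_bot]
    filter_upwards [h0, hae] with y hy hy'
    have hpos : 0 < dist X y := dist_pos.2 (by rintro rfl; exact hX hy')
    have : 0 < dist X y ^ (-s) := by positivity
    simp at hy
    linarith
  have hDI : ∀ X ∉ Γ, D X = I X ^ (-(1 / α)) := by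
    intro X hX
    rw [hD X hX, hIeq X hX, ← ENNReal.toReal_rpow, ENNReal.toReal_ofReal (hIpos X hX).le]
  refine ⟨?_, fun X hX => ?_⟩
  · refine ContDiffOn.congr (f := fun X => I X ^ (-(1 / α))) ?_ hDI
    exact hIc.rpow_const_of_ne fun x hx => (hIpos x hx).ne'
  have hIf : ∀ Y ∉ Γ, HasFDerivAt I (∫ y, fderiv ℝ g (Y - y) ∂σ) Y := fun Y hY =>
    hg.hasFDerivAt hs0 hclosed hnull hY (hint _ le_rfl Y hY) (hint _ (by linarith) Y hY)
  have hDf : ∀ Y ∉ Γ, fderiv ℝ D Y = (-(1 / α) * I Y ^ (-(1 / α) - 1)) • fderiv ℝ I Y := by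
    intro Y hY
    have he : D =ᶠ[𝓝 Y] fun Y => I Y ^ (-(1 / α)) := by
      filter_upwards [hclosed.isOpen_compl.mem_nhds hY] with Z hZ using hDI Z hZ
    rw [he.fderiv_eq, (hIf Y hY).fderiv]
    exact ((hIf Y hY).rpow_const (Or.inl (hIpos Y hY).ne')).fderiv
  set V : EuclideanSpace ℝ (Fin n) → EuclideanSpace ℝ (Fin n) :=
    fun Y => D Y ^ (d + 1 - (n : ℝ)) • gradient D Y with hV
  have hVi : ∀ Y ∉ Γ, ∀ i, V Y i = -(1 / α) * fderiv ℝ I Y (EuclideanSpace.single i 1) := by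
    intro Y hY i
    have h1 : gradient D Y i = fderiv ℝ D Y (EuclideanSpace.single i 1) := by
      have h2 : inner ℝ (gradient D Y) (EuclideanSpace.single i (1 : ℝ))
          = fderiv ℝ D Y (EuclideanSpace.single i 1) := by
        simp only [gradient, InnerProductSpace.toDual_symm_apply]
      rw [← h2, EuclideanSpace.inner_single_right]
      simp
    have hp := hIpos Y hY
    have h3 : D Y ^ (d + 1 - (n : ℝ)) * I Y ^ (-(1 / α) - 1) = 1 := by
      rw [hDI Y hY, ← Real.rpow_mul hp.le, ← Real.rpow_add hp, hn]
      have : -(1 / α) * (d + 1 - (d + 2 + α)) + (-(1 / α) - 1) = 0 := by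
        field_simp
        ring
      rw [this, Real.rpow_zero]
    simp only [hV, PiLp.smul_apply, h1, hDf Y hY, smul_eq_mul, smul_apply]
    linear_combination (-(1 / α) * fderiv ℝ I Y (EuclideanSpace.single i 1)) * h3
  have hgg : HasFDerivAt (fderiv ℝ I) (∫ y, fderiv ℝ (fderiv ℝ g) (X - y) ∂σ) X := by
    have he : fderiv ℝ I =ᶠ[𝓝 X] fun Y => ∫ y, fderiv ℝ g (Y - y) ∂σ := by
      filter_upwards [hclosed.isOpen_compl.mem_nhds hX] with Z hZ using (hIf Z hZ).fderiv
    refine HasFDerivAt.congr_of_eventuallyEq ?_ he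
    exact hg.fderivHom.hasFDerivAt (by linarith) hclosed hnull hX (hint _ (by linarith) X hX)
      (hint _ (by linarith) X hX)
  have hVd : ∀ i, HasFDerivAt (fun Y => V Y i) (-(1 / α) •
      (ContinuousLinearMap.apply ℝ ℝ (EuclideanSpace.single i (1 : ℝ))).comp
        (∫ y, fderiv ℝ (fderiv ℝ g) (X - y) ∂σ)) X := by
    intro i
    have he : (fun Y => V Y i) =ᶠ[𝓝 X]
        fun Y => -(1 / α) * fderiv ℝ I Y (EuclideanSpace.single i 1) := by
      filter_upwards [hclosed.isOpen_compl.mem_nhds hX] with Z hZ using hVi Z hZ i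
    refine HasFDerivAt.congr_of_eventuallyEq ?_ he
    exact (((ContinuousLinearMap.apply ℝ ℝ
      (EuclideanSpace.single i (1 : ℝ))).hasFDerivAt).comp X hgg).const_mul (-(1 / α))
  have hVdiff : DifferentiableAt ℝ V X :=
    differentiableAt_euclidean.2 fun i => (hVd i).differentiableAt
  have hcoord : ∀ i v, fderiv ℝ V X v i = -(1 / α) *
      (∫ y, fderiv ℝ (fderiv ℝ g) (X - y) ∂σ) v (EuclideanSpace.single i 1) := by
    intro i v
    have h1 := (((EuclideanSpace.proj (𝕜 := ℝ) i).hasFDerivAt.comp X hVdiff.hasFDerivAt)).unique (hVd i)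
    have h2 := congrArg (fun L => L v) h1
    simpa using h2
  have hint2 :=
    hg.fderivHom.fderivHom.integrable hclosed hnull hX (hint _ (by linarith) X hX)
  unfold vecDiv
  simp only [hcoord]
  rw [← Finset.mul_sum]
  have hsum : ∑ i : Fin n, (∫ y, fderiv ℝ (fderiv ℝ g) (X - y) ∂σ)
      (EuclideanSpace.single i 1) (EuclideanSpace.single i 1) = 0 := by
    have h1 : ∀ i : Fin n, (∫ y, fderiv ℝ (fderiv ℝ g) (X - y) ∂σ)
      (EuclideanSpace.single i 1) (EuclideanSpace.single i 1) =
        ∫ y, fderiv ℝ (fderiv ℝ g) (X - y)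
          (EuclideanSpace.single i 1) (EuclideanSpace.single i 1) ∂σ := by
      intro i
      rw [ContinuousLinearMap.integral_apply hint2,
        ContinuousLinearMap.integral_apply (hint2.apply_continuousLinearMap _)]
    simp only [h1]
    rw [← integral_finsetSum _ fun i _ =>
      (hint2.apply_continuousLinearMap _).apply_continuousLinearMap _]
    apply integral_eq_zero_of_ae
    filter_upwards [hae] with y hy
    exact kernel_laplacian s (by linarith) (X - y) (sub_ne_zero.2 (by rintro rfl; exact hX hy))
  rw [hsum, mul_zero]
end

section
/- Let Γ ⊂ ℝⁿ be d-dimensional Ahlfors regular with d < n−1 and Ω = ℝⁿ \ Γ, with weight w(X) = dist(X,Γ)^{d+1−n} and dm = w dX. Define W = {u ∈ L¹_loc(Ω) : ∇u ∈ L²(Ω, dm)}. Then W coincides with the set {u ∈ L²_loc(ℝⁿ) : ∇u ∈ L²(ℝⁿ, dm)} (in the sense that every element of W extends to such a function on ℝⁿ). -/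
open MeasureTheory Metric Set
open scoped ENNReal

section aux
open scoped Pointwise
set_option linter.unusedSectionVars false
variable {E : Type*} [NormedAddCommGroup E] [InnerProductSpace ℝ E] [FiniteDimensional ℝ E]
  [MeasurableSpace E] [BorelSpace E] (μ : Measure E) [μ.IsAddHaarMeasure]

lemma aux_closed {Γ : Set E} (hΓ : IsClosed Γ) (h : E) :
    IsClosed {x : E | ∃ s ∈ Icc (0:ℝ) 1, x + s • h ∈ Γ} := by
  have hc : IsCompact ((fun s : ℝ => -(s • h)) '' Icc (0:ℝ) 1) :=
    isCompact_Icc.image (by fun_prop)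
  have := hΓ.add_right_of_isCompact hc
  convert this using 1
  ext x
  simp only [mem_ofPred_eq, Set.mem_add, mem_image]
  constructor
  · rintro ⟨s, hs, hx⟩
    exact ⟨_, hx, _, ⟨s, hs, rfl⟩, by simp⟩
  · rintro ⟨y, hy, _, ⟨s, hs, rfl⟩, rfl⟩
    exact ⟨s, hs, by simpa using hy⟩

lemma aux_null {Γ : Set E} (hΓ : IsClosed Γ) (n : ℕ) (hn : Module.finrank ℝ E = n + 1)
    (hH : μH[(n:ℝ)] Γ = 0) (h : E) (hh : h ≠ 0) :
    μ {x : E | ∃ s ∈ Icc (0:ℝ) 1, x + s • h ∈ Γ} = 0 := by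
  set A := {x : E | ∃ s ∈ Icc (0:ℝ) 1, x + s • h ∈ Γ} with hA
  let V := (ℝ ∙ h)ᗮ
  have hV : Module.finrank ℝ V = n := by
    have : Fact (Module.finrank ℝ E = n + 1) := ⟨hn⟩
    exact Submodule.finrank_orthogonal_span_singleton hh
  have hmeas : MeasurableSet Aᶜ := (aux_closed hΓ h).measurableSet.compl
  have hpi : μH[(Module.finrank ℝ V : ℝ)] (V.orthogonalProjectionOnto '' Γ) = 0 := by
    have := (V.lipschitzWith_orthogonalProjectionOnto).hausdorffMeasure_image_le
      (d := (n:ℝ)) (by positivity) Γ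
    rw [hH, mul_zero] at this
    rw [hV]
    exact le_antisymm this zero_le
  have key : ∀ᵐ y ∂μ, y ∈ Aᶜ := by
    refine ae_mem_of_ae_add_linearMap_mem (𝕜 := ℝ) V.subtype
      (μH[(Module.finrank ℝ V : ℝ)] : Measure V) μ hmeas ?_
    intro y
    have h2 : μH[(Module.finrank ℝ V : ℝ)]
        ((fun z : V => V.orthogonalProjectionOnto y + z) ⁻¹' (V.orthogonalProjectionOnto '' Γ)) = 0 := by
      rw [measure_preimage_add]; exact hpi
    refine measure_mono_null ?_ h2
    intro z hz
    simp only [mem_compl_iff, mem_ofPred_eq, not_not, hA] at hz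
    obtain ⟨s, -, hs⟩ := hz
    refine ⟨_, hs, ?_⟩
    have e1 : V.orthogonalProjectionOnto h = 0 :=
      Submodule.orthogonalProjectionOnto_orthogonalComplement_singleton_eq_zero h
    have e2 : V.orthogonalProjectionOnto (z : E) = z :=
      Submodule.orthogonalProjectionOnto_mem_subspace_eq_self z
    simp [e1, e2]
  have := key
  rw [ae_iff] at this
  simpa using this

lemma aux_cont {f ψ : E → ℝ} (hf : Integrable f μ) (hψ : Continuous ψ)
    (hc : HasCompactSupport ψ) (h : E) :
    Continuous (fun s : ℝ => ∫ x, f x * ψ (x - s • h) ∂μ) := by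
  obtain ⟨C, hC⟩ := hψ.bounded_above_of_compact_support hc
  refine continuous_of_dominated (bound := fun x => ‖f x‖ * C) ?_ ?_ ?_ ?_
  · intro s
    exact hf.aestronglyMeasurable.mul (by fun_prop : Continuous fun x => ψ (x - s • h)).stronglyMeasurable.aestronglyMeasurable
  · intro s
    refine Filter.Eventually.of_forall fun x => ?_
    rw [norm_mul]
    gcongr
    exact hC _
  · exact hf.norm.mul_const C
  · refine Filter.Eventually.of_forall fun x => ?_
    fun_prop

lemma aux_deriv {f ψ : E → ℝ} (hf : Integrable f μ) (hψ : ContDiff ℝ (⊤ : ℕ∞) ψ)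
    (hc : HasCompactSupport ψ) (h : E) (s : ℝ) :
    HasDerivAt (fun s : ℝ => ∫ x, f x * ψ (x - s • h) ∂μ)
      (- ∫ x, f x * fderiv ℝ ψ (x - s • h) h ∂μ) s := by
  have hcd : Continuous (fun x => fderiv ℝ ψ x h) :=
    (hψ.continuous_fderiv (by simp)).clm_apply continuous_const
  have hcs : HasCompactSupport (fun x => fderiv ℝ ψ x h) := hc.fderiv_apply (𝕜 := ℝ) h
  obtain ⟨C, hC⟩ := hcd.bounded_above_of_compact_support hcs
  obtain ⟨D, hD⟩ := hψ.continuous.bounded_above_of_compact_support hc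
  have hψc := hψ.continuous
  have m1 : ∀ s : ℝ, AEStronglyMeasurable (fun x => f x * ψ (x - s • h)) μ := fun s =>
    hf.aestronglyMeasurable.mul (by fun_prop : Continuous fun x => ψ (x - s • h)).stronglyMeasurable.aestronglyMeasurable
  rw [← integral_neg]
  refine (hasDerivAt_integral_of_dominated_loc_of_deriv_le (μ := μ) (s := univ)
    (F := fun (s:ℝ) x => f x * ψ (x - s • h))
    (F' := fun (s:ℝ) x => -(f x * fderiv ℝ ψ (x - s • h) h))
    (bound := fun x => ‖f x‖ * C) Filter.univ_mem ?_ ?_ ?_ ?_ ?_ ?_).2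
  · exact Filter.Eventually.of_forall m1
  · refine Integrable.mono' (hf.norm.mul_const D) (m1 s) ?_
    refine Filter.Eventually.of_forall fun x => ?_
    rw [norm_mul]
    gcongr
    exact hD _
  · exact (hf.aestronglyMeasurable.mul
      (hcd.comp (by fun_prop : Continuous fun x => x - s • h)).stronglyMeasurable.aestronglyMeasurable).neg
  · refine Filter.Eventually.of_forall fun x s _ => ?_
    rw [norm_neg, norm_mul]
    gcongr
    exact hC _
  · exact hf.norm.mul_const C
  · refine Filter.Eventually.of_forall fun x s _ => ?_
    have h1 : HasDerivAt (fun s : ℝ => x - s • h) (-h) s := by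
      simpa using ((hasDerivAt_id s).smul_const h).const_sub x
    have h2 := ((hψ.differentiable (by simp)) (x - s • h)).hasFDerivAt.comp_hasDerivAt s h1
    have h3 := h2.const_mul (f x)
    simpa using h3

lemma aux_prod {γ : E → ℝ} (hm : Measurable γ) (hγ : LocallyIntegrable γ μ) (h : E)
    {K : Set E} (hK : IsCompact K) :
    Integrable (fun p : ℝ × E => γ (p.2 + p.1 • h))
      ((volume.restrict (Ioc (0:ℝ) 1)).prod (μ.restrict K)) := by
  have hmm : Measurable (fun p : ℝ × E => γ (p.2 + p.1 • h)) := hm.comp (by fun_prop)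
  refine ⟨hmm.aestronglyMeasurable, ?_⟩
  have hK' : IsCompact (K + (fun s : ℝ => s • h) '' Icc (0:ℝ) 1) :=
    hK.add (isCompact_Icc.image (by fun_prop))
  set K' := K + (fun s : ℝ => s • h) '' Icc (0:ℝ) 1
  have hI : (∫⁻ x in K', ‖γ x‖ₑ ∂μ) < ⊤ := (hγ.integrableOn_isCompact hK').2
  unfold HasFiniteIntegral
  rw [lintegral_prod _ hmm.enorm.aemeasurable]
  calc ∫⁻ s in Ioc (0:ℝ) 1, ∫⁻ x in K, ‖γ (x + s • h)‖ₑ ∂μ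
      ≤ ∫⁻ s in Ioc (0:ℝ) 1, ∫⁻ x in K', ‖γ x‖ₑ ∂μ := by
        refine setLIntegral_mono' measurableSet_Ioc fun s hs => ?_
        rw [← lintegral_indicator hK.measurableSet, ← lintegral_indicator hK'.measurableSet,
          ← lintegral_add_right_eq_self (K'.indicator fun x => ‖γ x‖ₑ) (s • h)]
        refine lintegral_mono fun x => ?_
        by_cases hx : x ∈ K
        · have : x + s • h ∈ K' := Set.add_mem_add hx ⟨s, ⟨hs.1.le, hs.2⟩, rfl⟩
          simp [hx, this]
        · simp [hx]
    _ < ⊤ := by simpa using hI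

lemma aux_loc {γ : E → ℝ} (hm : Measurable γ) (hγ : LocallyIntegrable γ μ) (h : E) :
    LocallyIntegrable (fun x => ∫ s in (0:ℝ)..1, γ (x + s • h)) μ := by
  rw [locallyIntegrable_iff]
  intro K hK
  have := (aux_prod μ hm hγ h hK).integral_prod_right
  simpa only [IntegrableOn, intervalIntegral.integral_of_le zero_le_one] using this

lemma aux_fubini {γ ψ : E → ℝ} (hm : Measurable γ) (hγ : LocallyIntegrable γ μ) (h : E)
    (hψ : Continuous ψ) (hc : HasCompactSupport ψ) :
    ∫ x, ψ x * (∫ s in (0:ℝ)..1, γ (x + s • h)) ∂μ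
      = ∫ s in (0:ℝ)..1, ∫ x, γ x * ψ (x - s • h) ∂μ := by
  obtain ⟨C, hC⟩ := hψ.bounded_above_of_compact_support hc
  have hK : IsCompact (tsupport ψ) := hc
  have hp := aux_prod μ hm hγ h hK
  have hp2 : Integrable (fun p : ℝ × E => ψ p.2 * γ (p.2 + p.1 • h))
      ((volume.restrict (Ioc (0:ℝ) 1)).prod (μ.restrict (tsupport ψ))) := by
    refine hp.bdd_mul (c := C) ?_ (Filter.Eventually.of_forall fun p => hC _)
    exact (hψ.comp continuous_snd).stronglyMeasurable.aestronglyMeasurable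
  have hsw := integral_integral_swap (f := fun (s : ℝ) (x : E) => ψ x * γ (x + s • h)) hp2
  have hz : ∀ x, x ∉ tsupport ψ → ψ x = 0 := fun x hx => image_eq_zero_of_notMem_tsupport hx
  have e1 : ∫ x, ψ x * (∫ s in (0:ℝ)..1, γ (x + s • h)) ∂μ
      = ∫ x in tsupport ψ, (∫ s in Ioc (0:ℝ) 1, ψ x * γ (x + s • h)) ∂μ := by
    rw [← setIntegral_eq_integral_of_forall_compl_eq_zero (s := tsupport ψ)
      (fun x hx => by simp [hz x hx])]
    refine integral_congr_ae (Filter.Eventually.of_forall fun x => ?_)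
    simp only [intervalIntegral.integral_of_le zero_le_one]
    rw [integral_const_mul]
  rw [e1, ← hsw, intervalIntegral.integral_of_le zero_le_one]
  refine integral_congr_ae (Filter.Eventually.of_forall fun s => ?_)
  simp only
  rw [setIntegral_eq_integral_of_forall_compl_eq_zero (s := tsupport ψ)
      (fun x hx => by simp [hz x hx]), ← integral_sub_right_eq_self _ (s • h)]
  simp [mul_comm]

lemma aux_int {w ψ : E → ℝ} {U : Set E} (hw : LocallyIntegrableOn w U μ)
    (hψ : Continuous ψ) (hc : HasCompactSupport ψ) (hs : tsupport ψ ⊆ U) :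
    Integrable (fun x => ψ x * w x) μ := by
  obtain ⟨C, hC⟩ := hψ.bounded_above_of_compact_support hc
  have h1 : IntegrableOn w (tsupport ψ) μ := hw.integrableOn_compact_subset hs hc
  have h2 : IntegrableOn (fun x => ψ x * w x) (tsupport ψ) μ :=
    h1.bdd_mul (c := C) hψ.stronglyMeasurable.aestronglyMeasurable
      (Filter.Eventually.of_forall fun p => hC _)
  refine (integrableOn_iff_integrable_of_support_subset ?_).1 h2
  intro x hx
  by_contra hx'
  exact hx (by simp [image_eq_zero_of_notMem_tsupport hx'])

lemma aux_tsupport (ψ : E → ℝ) (a : E) {x : E} (hx : x ∈ tsupport (fun y => ψ (y - a))) :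
    x - a ∈ tsupport ψ :=
  tsupport_comp_subset_preimage ψ (f := fun y => y - a) (by fun_prop) hx

lemma aux_key {Γ : Set E} (hΓ : IsClosed Γ) {u : E → ℝ} {g : E → E}
    (hu : LocallyIntegrableOn u Γᶜ μ) (hgm : Measurable g) (hg : LocallyIntegrable g μ)
    (hgrad : ∀ φ : E → ℝ, ContDiff ℝ (⊤ : ℕ∞) φ → HasCompactSupport φ →
      tsupport φ ⊆ Γᶜ → ∀ h : E, ∫ x, u x * fderiv ℝ φ x h ∂μ = - ∫ x, inner ℝ (g x) h * φ x ∂μ)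
    (hnull : ∀ h : E, h ≠ 0 → μ {x : E | ∃ s ∈ Icc (0:ℝ) 1, x + s • h ∈ Γ} = 0) (h : E) :
    ∀ᵐ x ∂μ, u (x + h) - u x = ∫ s in (0:ℝ)..1, inner ℝ (g (x + s • h)) h := by
  rcases eq_or_ne h 0 with rfl | hh
  · simp
  have hAc := aux_closed hΓ h
  have hA0 := hnull h hh
  set A := {x : E | ∃ s ∈ Icc (0:ℝ) 1, x + s • h ∈ Γ} with hA
  have hO : IsOpen Aᶜ := hAc.isOpen_compl
  let γ : E → ℝ := fun x => inner ℝ (g x) h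
  have hγm : Measurable γ := hgm.inner_const
  have hγ : LocallyIntegrable γ μ := by
    rw [locallyIntegrable_iff] at hg ⊢
    intro K hK
    exact (hg K hK).inner_const h
  have hOΓ : ∀ x ∈ Aᶜ, ∀ s ∈ Icc (0:ℝ) 1, x + s • h ∈ Γᶜ := by
    intro x hx s hs hxs
    exact hx ⟨s, hs, hxs⟩
  have hl1 : LocallyIntegrableOn u Aᶜ μ := by
    refine hu.mono_set fun x hx => ?_
    simpa using hOΓ x hx 0 (by simp)
  have hl2 : LocallyIntegrableOn (fun x => u (x + h)) Aᶜ μ := by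
    rw [locallyIntegrableOn_iff hO.isLocallyClosed]
    intro K hK hKc
    have h1 : IntegrableOn u ((fun x => x + h) '' K) μ := by
      refine hu.integrableOn_compact_subset ?_ (hKc.image (by fun_prop))
      rintro _ ⟨x, hx, rfl⟩
      simpa using hOΓ x (hK hx) 1 (by simp)
    have h2 := ((measurePreserving_add_right μ h).integrableOn_comp_preimage
      (MeasurableEquiv.addRight h).measurableEmbedding (f := u)
      (s := (fun x => x + h) '' K)).2 h1
    rwa [preimage_image_eq _ (add_left_injective h)] at h2
  have hl3 : LocallyIntegrableOn (fun x => ∫ s in (0:ℝ)..1, γ (x + s • h)) Aᶜ μ :=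
    (aux_loc μ hγm hγ h).locallyIntegrableOn _
  have main := hO.ae_eq_zero_of_integral_contDiff_smul_eq_zero ((hl2.sub hl1).sub hl3) ?_
  · have : Aᶜ ∈ ae μ := compl_mem_ae_iff.2 hA0
    filter_upwards [main, this] with x hx hxA
    have := hx hxA
    simp only [Pi.sub_apply] at this
    linarith
  intro ψ hψ hc hs
  have hψc := hψ.continuous
  have hdc : Continuous (fun x => fderiv ℝ ψ x h) :=
    (hψ.continuous_fderiv (by simp)).clm_apply continuous_const
  have hdcs : HasCompactSupport (fun x => fderiv ℝ ψ x h) := hc.fderiv_apply (𝕜 := ℝ) h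
  have hK : IsCompact (tsupport ψ + (fun s : ℝ => s • h) '' Icc (0:ℝ) 1) :=
    IsCompact.add hc (isCompact_Icc.image (by fun_prop))
  set K := tsupport ψ + (fun s : ℝ => s • h) '' Icc (0:ℝ) 1 with hKdef
  have hKΓ : K ⊆ Γᶜ := by
    rintro _ ⟨x, hx, _, ⟨s, hs', rfl⟩, rfl⟩
    exact hOΓ x (hs hx) s hs'
  have hmemK : ∀ s ∈ Icc (0:ℝ) 1, ∀ x, x - s • h ∈ tsupport ψ → x ∈ K := by
    intro s hs' x hx
    exact ⟨_, hx, _, ⟨s, hs', rfl⟩, by simp⟩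
  have hui : Integrable (K.indicator u) μ :=
    (integrable_indicator_iff hK.measurableSet).2 (hu.integrableOn_compact_subset hKΓ hK)
  have hF := aux_deriv μ hui hψ hc h
  have hF' : ∀ s ∈ Icc (0:ℝ) 1, - ∫ x, K.indicator u x * fderiv ℝ ψ (x - s • h) h ∂μ
      = ∫ x, γ x * ψ (x - s • h) ∂μ := by
    intro s hs'
    have hts : ∀ x ∈ tsupport (fun y => ψ (y - s • h)), x ∈ K := fun x hx =>
      hmemK s hs' x (aux_tsupport ψ _ hx)
    have hcs : HasCompactSupport (fun y => ψ (y - s • h)) :=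
      HasCompactSupport.of_support_subset_isCompact hK
        (fun x hx => hts x (subset_tsupport _ hx))
    have := hgrad (fun y => ψ (y - s • h)) (by fun_prop) hcs (fun x hx => hKΓ (hts x hx)) h
    rw [neg_eq_iff_eq_neg, ← this]
    refine integral_congr_ae (Filter.Eventually.of_forall fun x => ?_)
    simp only [fderiv_comp_sub]
    by_cases hx : x ∈ K
    · simp [hx]
    · have : x - s • h ∉ tsupport (fderiv ℝ ψ) := fun hx' =>
        hx (hmemK s hs' x (tsupport_fderiv_subset ℝ hx'))
      simp [image_eq_zero_of_notMem_tsupport this]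
  have hval : ∀ s ∈ Icc (0:ℝ) 1, ∫ x, K.indicator u x * ψ (x - s • h) ∂μ
      = ∫ x, ψ x * u (x + s • h) ∂μ := by
    intro s hs'
    rw [← integral_sub_right_eq_self (fun x => ψ x * u (x + s • h)) (s • h)]
    refine integral_congr_ae (Filter.Eventually.of_forall fun x => ?_)
    simp only [sub_add_cancel]
    by_cases hx : x ∈ K
    · simp [hx, mul_comm]
    · have : x - s • h ∉ tsupport ψ := fun hx' => hx (hmemK s hs' x hx')
      simp [image_eq_zero_of_notMem_tsupport this]
  have hftc := intervalIntegral.integral_eq_sub_of_hasDerivAt (a := 0) (b := 1)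
    (fun s _ => hF s) ((aux_cont μ hui hdc hdcs h).neg.intervalIntegrable _ _)
  rw [hval 1 (by simp), hval 0 (by simp)] at hftc
  have h4 : ∫ s in (0:ℝ)..1, - ∫ x, K.indicator u x * fderiv ℝ ψ (x - s • h) h ∂μ
      = ∫ s in (0:ℝ)..1, ∫ x, γ x * ψ (x - s • h) ∂μ := by
    refine intervalIntegral.integral_congr fun s hs' => ?_
    rw [uIcc_of_le zero_le_one] at hs'
    exact hF' s hs'
  rw [h4, ← aux_fubini μ hγm hγ h hψc hc] at hftc
  simp only [one_smul, zero_smul, add_zero] at hftc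
  simp only [Pi.sub_apply, smul_eq_mul, mul_sub]
  rw [integral_sub, integral_sub, ← hftc, sub_self]
  · exact aux_int μ hl2 hψc hc hs
  · exact aux_int μ hl1 hψc hc hs
  · exact (aux_int μ hl2 hψc hc hs).sub (aux_int μ hl1 hψc hc hs)
  · exact aux_int μ hl3 hψc hc hs

lemma aux_cs {f : ℝ → ℝ≥0∞} (hf : Measurable f) :
    (∫⁻ s in Ioc (0:ℝ) 1, f s) ^ 2 ≤ ∫⁻ s in Ioc (0:ℝ) 1, f s ^ 2 := by
  have h := ENNReal.lintegral_mul_le_Lp_mul_Lq (volume.restrict (Ioc (0:ℝ) 1))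
    Real.HolderConjugate.two_two hf.aemeasurable (g := fun _ => 1) aemeasurable_const
  have h1 : (∫⁻ s in Ioc (0:ℝ) 1, f s) ≤ (∫⁻ s in Ioc (0:ℝ) 1, f s ^ 2) ^ (1/2 : ℝ) := by
    simpa using h
  calc _ ≤ ((∫⁻ s in Ioc (0:ℝ) 1, f s ^ 2) ^ (1/2 : ℝ)) ^ 2 := by gcongr
    _ = _ := by rw [← ENNReal.rpow_natCast, ← ENNReal.rpow_mul]; norm_num

lemma aux_L2 {u : E → ℝ} {g : E → E} (hum : Measurable u) (hgm : Measurable g)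
    (hg2 : ∀ R : ℝ, (∫⁻ x in ball 0 R, ‖g x‖ₑ ^ 2 ∂μ) < ⊤)
    (hkey : ∀ h : E, ∀ᵐ x ∂μ, u (x + h) - u x = ∫ s in (0:ℝ)..1, inner ℝ (g (x + s • h)) h)
    (R : ℝ) (hR : 0 < R) : MemLp u 2 (μ.restrict (ball 0 R)) := by
  have hb : ∀ h ∈ ball (0:E) (2 * R), ∫⁻ x in ball (0:E) R, ‖u (x + h) - u x‖ₑ ^ 2 ∂μ
      ≤ ENNReal.ofReal (2 * R) ^ 2 * ∫⁻ x in ball (0:E) (3 * R), ‖g x‖ₑ ^ 2 ∂μ := by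
    intro h hh
    have hh' : ‖h‖ < 2 * R := by simpa using hh
    have p : ∀ᵐ x ∂(μ.restrict (ball (0:E) R)), ‖u (x + h) - u x‖ₑ ^ 2
        ≤ ENNReal.ofReal (2 * R) ^ 2 * ∫⁻ s in Ioc (0:ℝ) 1, ‖g (x + s • h)‖ₑ ^ 2 := by
      refine ae_restrict_of_ae ?_
      filter_upwards [hkey h] with x hx
      rw [hx, intervalIntegral.integral_of_le zero_le_one]
      have hm1 : Measurable fun s : ℝ => ‖g (x + s • h)‖ₑ := (hgm.comp (by fun_prop)).enorm
      calc ‖∫ s in Ioc (0:ℝ) 1, inner ℝ (g (x + s • h)) h‖ₑ ^ 2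
          ≤ (∫⁻ s in Ioc (0:ℝ) 1, ENNReal.ofReal (2 * R) * ‖g (x + s • h)‖ₑ) ^ 2 := by
            gcongr
            refine (enorm_integral_le_lintegral_enorm _).trans (lintegral_mono fun s => ?_)
            simp only
            rw [← ofReal_norm, ← ofReal_norm,
              ← ENNReal.ofReal_mul (by positivity)]
            refine ENNReal.ofReal_le_ofReal ((norm_inner_le_norm _ _).trans ?_)
            rw [mul_comm]
            gcongr
        _ ≤ _ := by
            rw [lintegral_const_mul _ hm1, mul_pow]
            gcongr
            exact aux_cs hm1
    have hm2 : Measurable fun p : E × ℝ => ‖g (p.1 + p.2 • h)‖ₑ ^ 2 :=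
      (hgm.comp (by fun_prop)).enorm.pow_const 2
    refine (lintegral_mono_ae p).trans ?_
    rw [lintegral_const_mul _ hm2.lintegral_prod_right]
    refine mul_le_mul_right ?_ _
    rw [lintegral_lintegral_swap (f := fun x s => ‖g (x + s • h)‖ₑ ^ 2) hm2.aemeasurable]
    calc _ ≤ ∫⁻ s in Ioc (0:ℝ) 1, ∫⁻ x in ball (0:E) (3 * R), ‖g x‖ₑ ^ 2 ∂μ := by
          refine setLIntegral_mono' measurableSet_Ioc fun s hs => ?_
          rw [← lintegral_indicator measurableSet_ball, ← lintegral_indicator measurableSet_ball,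
            ← lintegral_add_right_eq_self ((ball (0:E) (3 * R)).indicator fun x => ‖g x‖ₑ ^ 2) (s • h)]
          refine lintegral_mono fun x => ?_
          by_cases hx : x ∈ ball (0:E) R
          · have : x + s • h ∈ ball (0:E) (3 * R) := by
              have hx' : ‖x‖ < R := by simpa using hx
              have h3 : ‖s • h‖ ≤ ‖h‖ := by
                rw [norm_smul, Real.norm_of_nonneg hs.1.le]
                exact mul_le_of_le_one_left (norm_nonneg _) hs.2
              have := norm_add_le x (s • h)
              rw [mem_ball_zero_iff]; linarith
            rw [indicator_of_mem hx, indicator_of_mem this]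
          · rw [indicator_of_notMem hx]; exact zero_le
      _ = _ := by simp
  have hm3 : Measurable fun p : E × E => ‖u (p.1 + p.2) - u p.1‖ₑ ^ 2 :=
    ((hum.comp (by fun_prop)).sub (hum.comp measurable_fst)).enorm.pow_const 2
  have htot : ∫⁻ x in ball (0:E) R, ∫⁻ h in ball (0:E) (2 * R), ‖u (x + h) - u x‖ₑ ^ 2 ∂μ ∂μ < ⊤ := by
    rw [lintegral_lintegral_swap hm3.aemeasurable]
    calc _ ≤ ∫⁻ h in ball (0:E) (2 * R),
          ENNReal.ofReal (2 * R) ^ 2 * ∫⁻ x in ball (0:E) (3 * R), ‖g x‖ₑ ^ 2 ∂μ ∂μ :=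
          setLIntegral_mono' measurableSet_ball hb
      _ < ⊤ := by
          rw [setLIntegral_const]
          exact ENNReal.mul_lt_top (ENNReal.mul_lt_top (ENNReal.pow_lt_top ENNReal.ofReal_lt_top) (hg2 _)) measure_ball_lt_top
  have hae := ae_lt_top (hm3.lintegral_prod_right (ν := μ.restrict (ball (0:E) (2*R)))) htot.ne
  have hne : (ae (μ.restrict (ball (0:E) R))).NeBot := by
    rw [ae_neBot, Ne, Measure.restrict_eq_zero]
    exact (measure_ball_pos μ _ hR).ne'
  obtain ⟨x, hx, hxR⟩ := (hae.and (ae_restrict_mem measurableSet_ball)).exists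
  have hfin : IsFiniteMeasure (μ.restrict (ball (0:E) (2*R))) :=
    ⟨by simpa using measure_ball_lt_top⟩
  have h1 : MemLp (fun h => u (x + h) - u x) 2 (μ.restrict (ball (0:E) (2*R))) := by
    refine ⟨((hum.comp (by fun_prop)).sub_const _).aestronglyMeasurable, ?_⟩
    rw [eLpNorm_lt_top_iff_lintegral_rpow_enorm_lt_top (by simp) (by simp)]
    simpa using hx
  have h2 : MemLp (fun h => u (x + h)) 2 (μ.restrict (ball (0:E) (2*R))) := by
    convert h1.add (memLp_const (u x)) using 1
    ext h; simp
  have h3 : MemLp u 2 (μ.restrict (ball x (2*R))) := by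
    have hmp := (measurePreserving_add_left μ x).restrict_preimage
      (s := ball x (2*R)) measurableSet_ball
    have hpre : (fun y => x + y) ⁻¹' ball x (2*R) = ball (0:E) (2*R) := by
      ext y; simp
    rw [hpre] at hmp
    rw [← hmp.map_eq]
    exact ((MeasurableEquiv.addLeft x).measurableEmbedding.memLp_map_measure_iff).2 h2
  refine h3.mono_measure (Measure.restrict_mono ?_ le_rfl)
  intro y hy
  rw [mem_ball_zero_iff] at hy hxR
  rw [mem_ball, dist_eq_norm]
  have := norm_sub_le y x
  linarith

lemma aux_grad {u : E → ℝ} {g : E → E} (hu : LocallyIntegrable u μ) (hgm : Measurable g)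
    (hg : LocallyIntegrable g μ)
    (hkey : ∀ h : E, ∀ᵐ x ∂μ, u (x + h) - u x = ∫ s in (0:ℝ)..1, inner ℝ (g (x + s • h)) h)
    {φ : E → ℝ} (hφ : ContDiff ℝ (⊤ : ℕ∞) φ) (hc : HasCompactSupport φ) (h : E) :
    ∫ x, u x * fderiv ℝ φ x h ∂μ = - ∫ x, inner ℝ (g x) h * φ x ∂μ := by
  have hφc := hφ.continuous
  let γ : E → ℝ := fun x => inner ℝ (g x) h
  have hγm : Measurable γ := hgm.inner_const
  have hγ : LocallyIntegrable γ μ := by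
    rw [locallyIntegrable_iff] at hg ⊢
    intro K hK
    exact (hg K hK).inner_const h
  have hK : IsCompact (tsupport φ + (fun s : ℝ => s • h) '' Icc (-1:ℝ) 1) :=
    IsCompact.add hc (isCompact_Icc.image (by fun_prop))
  set K := tsupport φ + (fun s : ℝ => s • h) '' Icc (-1:ℝ) 1 with hKdef
  have hmemK : ∀ s ∈ Icc (-1:ℝ) 1, ∀ x, x - s • h ∈ tsupport φ → x ∈ K := by
    intro s hs' x hx
    exact ⟨_, hx, _, ⟨s, hs', rfl⟩, by simp⟩
  have hui : Integrable (K.indicator u) μ :=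
    (integrable_indicator_iff hK.measurableSet).2 (hu.integrableOn_isCompact hK)
  have hγi : Integrable (K.indicator γ) μ :=
    (integrable_indicator_iff hK.measurableSet).2 (hγ.integrableOn_isCompact hK)
  have hval : ∀ (w : E → ℝ), ∀ s ∈ Icc (-1:ℝ) 1, ∫ x, K.indicator w x * φ (x - s • h) ∂μ
      = ∫ x, w x * φ (x - s • h) ∂μ := by
    intro w s hs'
    refine integral_congr_ae (Filter.Eventually.of_forall fun x => ?_)
    simp only
    by_cases hx : x ∈ K
    · simp [hx]
    · have : x - s • h ∉ tsupport φ := fun hx' => hx (hmemK s hs' x hx')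
      simp [image_eq_zero_of_notMem_tsupport this]
  have hval' : ∫ x, K.indicator u x * fderiv ℝ φ x h ∂μ = ∫ x, u x * fderiv ℝ φ x h ∂μ := by
    refine integral_congr_ae (Filter.Eventually.of_forall fun x => ?_)
    simp only
    by_cases hx : x ∈ K
    · simp [hx]
    · have : x ∉ tsupport (fderiv ℝ φ) := fun hx' =>
        hx (hmemK 0 (by simp) x (by simpa using tsupport_fderiv_subset ℝ hx'))
      simp [image_eq_zero_of_notMem_tsupport this]
  let F : ℝ → ℝ := fun s => ∫ x, K.indicator u x * φ (x - s • h) ∂μ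
  let H : ℝ → ℝ := fun s => ∫ x, K.indicator γ x * φ (x - s • h) ∂μ
  have hHc : Continuous H := aux_cont μ hγi hφc hc h
  have hd1 : HasDerivAt F (- ∫ x, u x * fderiv ℝ φ x h ∂μ) 0 := by
    have := aux_deriv μ hui hφ hc h 0
    simp only [zero_smul, sub_zero] at this
    rwa [hval'] at this
  have hid : ∀ t ∈ Icc (-1:ℝ) 1, F t = F 0 + ∫ s in (0:ℝ)..t, H s := by
    intro t ht
    have e1 : F t = ∫ x, φ x * u (x + t • h) ∂μ := by
      simp only [F]
      rw [hval u t ht, ← integral_sub_right_eq_self (fun x => φ x * u (x + t • h)) (t • h)]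
      simp [mul_comm]
    have e0 : F 0 = ∫ x, φ x * u x ∂μ := by
      simp only [F]
      rw [hval u 0 (by simp)]
      simp [mul_comm]
    have hγ' : LocallyIntegrable (fun x => t * γ x) μ := hγ.smul t
    have hfub := aux_fubini μ (hγm.const_mul t) hγ' (t • h) hφc hc
    have hlu : LocallyIntegrable (fun x => u (x + t • h)) μ := by
      rw [locallyIntegrable_iff]
      intro K hKc
      have h2 := ((measurePreserving_add_right μ (t • h)).integrableOn_comp_preimage
        (MeasurableEquiv.addRight (t • h)).measurableEmbedding (f := u)
        (s := (fun x => x + t • h) '' K)).2 (hu.integrableOn_isCompact (hKc.image (by fun_prop)))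
      rwa [preimage_image_eq _ (add_left_injective (t • h))] at h2
    have i1 := aux_int μ (hlu.locallyIntegrableOn univ) hφc hc (subset_univ _)
    have i2 := aux_int μ (hu.locallyIntegrableOn univ) hφc hc (subset_univ _)
    have e2 : ∫ x, φ x * (∫ s in (0:ℝ)..1, t * γ (x + s • t • h)) ∂μ = F t - F 0 := by
      rw [e1, e0, ← integral_sub i1 i2]
      refine integral_congr_ae ?_
      filter_upwards [hkey (t • h)] with x hx
      rw [← mul_sub, hx]
      simp only [γ, inner_smul_right]
    rw [hfub] at e2
    have e3 : ∫ s in (0:ℝ)..t, H s = ∫ s in (0:ℝ)..1, ∫ x, t * γ x * φ (x - s • t • h) ∂μ := by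
      have := intervalIntegral.mul_integral_comp_mul_left (f := H) (a := 0) (b := 1) t
      rw [mul_zero, mul_one] at this
      rw [← this, ← intervalIntegral.integral_const_mul]
      refine intervalIntegral.integral_congr fun s hs => ?_
      rw [uIcc_of_le zero_le_one] at hs
      have hts : t * s ∈ Icc (-1:ℝ) 1 := by
        rw [mem_Icc, ← abs_le] at ht ⊢
        rw [abs_mul, abs_of_nonneg hs.1]
        exact mul_le_one₀ ht hs.1 hs.2
      simp only [H]
      rw [hval γ _ hts, ← integral_const_mul]
      simp only [smul_smul, mul_assoc, mul_comm s t]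
    rw [e3, e2]; ring
  have hd2 : HasDerivAt F (H 0) 0 := by
    have := (intervalIntegral.integral_hasDerivAt_right (hHc.intervalIntegrable 0 0)
      hHc.stronglyMeasurable.stronglyMeasurableAtFilter hHc.continuousAt).const_add (F 0)
    refine this.congr_of_eventuallyEq ?_
    filter_upwards [Icc_mem_nhds (show (-1:ℝ) < 0 by norm_num) (show (0:ℝ) < 1 by norm_num)] with t ht
    exact hid t ht
  have := hd1.unique hd2
  simp only [H] at this
  rw [hval γ 0 (by simp)] at this
  simp only [zero_smul, sub_zero, γ] at this
  linarith
end aux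

theorem energy_space_extension
    (n : ℕ) (d C₀ : ℝ) (hd₀ : 0 ≤ d) (hd : d < (n : ℝ) - 1) (hC₀ : 0 < C₀)
    (Γ : Set (EuclideanSpace ℝ (Fin n))) (hclosed : IsClosed Γ) (hΓne : Γ.Nonempty)
    (hunb : ¬ Bornology.IsBounded Γ)
    (hAR : ∀ x ∈ Γ, ∀ r : ℝ, 0 < r →
      ENNReal.ofReal (C₀⁻¹ * r ^ d) ≤ μH[d] (Γ ∩ ball x r) ∧
      μH[d] (Γ ∩ ball x r) ≤ ENNReal.ofReal (C₀ * r ^ d))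
    (u : EuclideanSpace ℝ (Fin n) → ℝ)
    (hu : LocallyIntegrableOn u Γᶜ volume)
    (g : EuclideanSpace ℝ (Fin n) → EuclideanSpace ℝ (Fin n))
    (hgmeas : AEStronglyMeasurable g volume)
    -- g is the distributional gradient of u in Ω = ℝⁿ \ Γ
    (hgrad : ∀ φ : EuclideanSpace ℝ (Fin n) → ℝ, ContDiff ℝ (⊤ : ℕ∞) φ → HasCompactSupport φ →
      tsupport φ ⊆ Γᶜ → ∀ i : Fin n,
        ∫ x, u x * fderiv ℝ φ x (EuclideanSpace.single i 1) = - ∫ x, g x i * φ x)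
    -- ∇u ∈ L²(Ω, w dX)
    (hgL2 : (∫⁻ x in Γᶜ,
        ENNReal.ofReal (‖g x‖ ^ 2 * Metric.infDist x Γ ^ (d + 1 - (n : ℝ)))) < ⊤) :
    ∃ v : EuclideanSpace ℝ (Fin n) → ℝ,
      (∀ᵐ x ∂(volume.restrict Γᶜ), v x = u x) ∧
      MeasureTheory.LocallyIntegrable (fun x => (v x) ^ 2) volume ∧
      (∀ φ : EuclideanSpace ℝ (Fin n) → ℝ, ContDiff ℝ (⊤ : ℕ∞) φ → HasCompactSupport φ →
        ∀ i : Fin n,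
          ∫ x, v x * fderiv ℝ φ x (EuclideanSpace.single i 1) = - ∫ x, g x i * φ x) ∧
      (∫⁻ x, ENNReal.ofReal (‖g x‖ ^ 2 * Metric.infDist x Γ ^ (d + 1 - (n : ℝ)))) < ⊤ := by
  obtain ⟨x₀, hx₀⟩ := hΓne
  obtain ⟨m, rfl⟩ : ∃ m, n = m + 1 := by
    cases n with
    | zero => exfalso; norm_num at hd; linarith
    | succ m => exact ⟨m, rfl⟩
  have hdm : d < (m : ℝ) := by push_cast at hd; linarith
  have hH : μH[(m : ℝ)] Γ = 0 := by
    have hcov : Γ ⊆ ⋃ k : ℕ, Γ ∩ ball x₀ (k + 1) := by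
      intro x hx
      obtain ⟨k, hk⟩ := exists_nat_gt (dist x x₀)
      exact mem_iUnion.2 ⟨k, hx, by rw [mem_ball]; linarith⟩
    refine measure_mono_null hcov (measure_iUnion_null fun k => ?_)
    rcases Measure.hausdorffMeasure_zero_or_top hdm (Γ ∩ ball x₀ (k + 1)) with h | h
    · exact h
    · have := (hAR x₀ hx₀ (k + 1) (by positivity)).2
      rw [h] at this
      exact absurd this (by simp)
  have hnull := aux_null (volume : Measure (EuclideanSpace ℝ (Fin (m + 1)))) hclosed m (by simp) hH
  have hvol : volume Γ = 0 := by
    refine measure_mono_null ?_ (hnull (EuclideanSpace.single 0 1) (by simp))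
    intro x hx
    exact ⟨0, by simp, by simpa using hx⟩
  have hres : (volume : Measure (EuclideanSpace ℝ (Fin (m + 1)))).restrict Γᶜ = volume :=
    Measure.restrict_eq_self_of_ae_mem (compl_mem_ae_iff.2 hvol)
  have hum : AEStronglyMeasurable u volume := by
    have := hu.aestronglyMeasurable
    rwa [hres] at this
  rw [hres] at hgL2
  let u' := hum.mk u
  let g' := hgmeas.mk g
  have hu' : u =ᵐ[volume] u' := hum.ae_eq_mk
  have hg' : g =ᵐ[volume] g' := hgmeas.ae_eq_mk
  have hu'm : Measurable u' := hum.stronglyMeasurable_mk.measurable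
  have hg'm : Measurable g' := hgmeas.stronglyMeasurable_mk.measurable
  have hu'l : LocallyIntegrableOn u' Γᶜ volume := by
    rw [locallyIntegrableOn_iff hclosed.isOpen_compl.isLocallyClosed] at hu ⊢
    intro K hK hKc
    exact (hu K hK hKc).congr_fun_ae (ae_restrict_of_ae hu')
  have hg2 : ∀ R : ℝ, (∫⁻ x in ball 0 R, ‖g' x‖ₑ ^ 2) < ⊤ := by
    intro R
    set D : ℝ := |R| + ‖x₀‖ + 1 with hD
    have hDp : 0 < D := by positivity
    set c : ℝ := D ^ (d + 1 - ((m + 1 : ℕ) : ℝ)) with hc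
    have hcp : 0 < c := Real.rpow_pos_of_pos hDp _
    have hle : ENNReal.ofReal c * (∫⁻ x in ball 0 R, ‖g' x‖ₑ ^ 2) ≤ ∫⁻ x,
        ENNReal.ofReal (‖g x‖ ^ 2 * Metric.infDist x Γ ^ (d + 1 - ((m + 1 : ℕ) : ℝ))) := by
      rw [← lintegral_const_mul _ (hg'm.enorm.pow_const 2)]
      refine le_trans ?_ (setLIntegral_le_lintegral (ball 0 R) _)
      refine lintegral_mono_ae ?_
      filter_upwards [ae_restrict_of_ae hg', ae_restrict_mem measurableSet_ball,
        ae_restrict_of_ae (compl_mem_ae_iff.2 hvol)] with x hx hxR hxΓ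
      have hpos : 0 < infDist x Γ :=
        (hclosed.notMem_iff_infDist_pos ⟨x₀, hx₀⟩).1 hxΓ
      have hleD : infDist x Γ ≤ D := by
        have h1 := infDist_le_dist_of_mem (x := x) hx₀
        have h2 := norm_sub_le x x₀
        rw [mem_ball_zero_iff] at hxR
        rw [dist_eq_norm] at h1
        have := le_abs_self R
        linarith
      rw [← hx, ← ofReal_norm, ← ENNReal.ofReal_pow (by positivity),
        ← ENNReal.ofReal_mul hcp.le]
      refine ENNReal.ofReal_le_ofReal ?_
      rw [mul_comm]
      gcongr
      exact Real.rpow_le_rpow_of_nonpos hpos hleD (by push_cast; linarith)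
    have h1 := hle.trans_lt hgL2
    exact ENNReal.lt_top_of_mul_ne_top_right h1.ne (by simpa using hcp)
  have hgl : LocallyIntegrable g' volume := by
    intro x
    refine ⟨ball 0 (‖x‖ + 1), isOpen_ball.mem_nhds (by simp), ?_⟩
    have hfin : IsFiniteMeasure ((volume : Measure (EuclideanSpace ℝ (Fin (m + 1)))).restrict
      (ball 0 (‖x‖ + 1))) := ⟨by simpa using measure_ball_lt_top⟩
    have : MemLp g' 2 (volume.restrict (ball 0 (‖x‖ + 1))) := by
      refine ⟨hg'm.aestronglyMeasurable, ?_⟩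
      rw [eLpNorm_lt_top_iff_lintegral_rpow_enorm_lt_top (by simp) (by simp)]
      simpa using hg2 (‖x‖ + 1)
    exact this.integrable (by norm_num)
  have hgrad' : ∀ φ : EuclideanSpace ℝ (Fin (m + 1)) → ℝ, ContDiff ℝ (⊤ : ℕ∞) φ →
      HasCompactSupport φ → tsupport φ ⊆ Γᶜ → ∀ h,
        ∫ x, u' x * fderiv ℝ φ x h = - ∫ x, inner ℝ (g' x) h * φ x := by
    intro φ hφ hc hs h
    have hi : ∀ i, ∫ x, u' x * fderiv ℝ φ x (EuclideanSpace.single i 1)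
        = - ∫ x, g' x i * φ x := by
      intro i
      have e1 : ∫ x, u' x * fderiv ℝ φ x (EuclideanSpace.single i 1)
          = ∫ x, u x * fderiv ℝ φ x (EuclideanSpace.single i 1) := by
        refine integral_congr_ae ?_
        filter_upwards [hu'] with x hx
        rw [hx]
      have e2 : ∫ x, g' x i * φ x = ∫ x, g x i * φ x := by
        refine integral_congr_ae ?_
        filter_upwards [hg'] with x hx
        rw [hx]
      rw [e1, e2]
      exact hgrad φ hφ hc hs i
    have hh : h = ∑ i, h i • EuclideanSpace.single i (1:ℝ) := by
      ext j
      simp [Finset.sum_apply, Pi.single_apply]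
    have e1 : ∀ x, u' x * fderiv ℝ φ x h
        = ∑ i, h i * (fderiv ℝ φ x (EuclideanSpace.single i 1) * u' x) := by
      intro x
      conv_lhs => rw [hh]
      simp only [map_sum, map_smul, smul_eq_mul, Finset.mul_sum]
      exact Finset.sum_congr rfl fun i _ => by ring
    have e2 : ∀ x, inner ℝ (g' x) h * φ x = ∑ i, h i * (φ x * g' x i) := by
      intro x
      simp only [PiLp.inner_apply, Finset.sum_mul]
      exact Finset.sum_congr rfl fun i _ => by simp; ring
    simp only [e1, e2]
    rw [integral_finsetSum, integral_finsetSum, ← Finset.sum_neg_distrib]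
    · refine Finset.sum_congr rfl fun i _ => ?_
      rw [integral_const_mul, integral_const_mul, ← mul_neg]
      have := hi i
      simp only [mul_comm (u' _), mul_comm (g' _ i)] at this
      rw [this]
    · intro i _
      refine Integrable.const_mul (aux_int volume (U := univ) ?_ hφ.continuous hc (subset_univ _)) _
      refine LocallyIntegrable.locallyIntegrableOn ?_ _
      rw [locallyIntegrable_iff] at hgl ⊢
      intro K hK
      have := (hgl K hK).inner_const (𝕜 := ℝ) (EuclideanSpace.single i 1)
      simpa [IntegrableOn, EuclideanSpace.inner_single_right] using this
    · intro i _
      refine Integrable.const_mul (aux_int volume hu'l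
        ((hφ.continuous_fderiv (by simp)).clm_apply continuous_const)
        (hc.fderiv_apply (𝕜 := ℝ) _) ?_) _
      exact (tsupport_fderiv_apply_subset ℝ _).trans hs
  have hkey := aux_key volume hclosed hu'l hg'm hgl hgrad' hnull
  have hL2 := aux_L2 volume hu'm hg'm hg2 hkey
  have hul : LocallyIntegrable u' volume := by
    intro x
    refine ⟨ball 0 (‖x‖ + 1), isOpen_ball.mem_nhds (by simp), ?_⟩
    have hfin : IsFiniteMeasure ((volume : Measure (EuclideanSpace ℝ (Fin (m + 1)))).restrict
      (ball 0 (‖x‖ + 1))) := ⟨by simpa using measure_ball_lt_top⟩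
    exact (hL2 _ (by positivity)).integrable (by norm_num)
  refine ⟨u', ?_, ?_, ?_, hgL2⟩
  · rw [hres]; exact hu'.symm
  · intro x
    exact ⟨ball 0 (‖x‖ + 1), isOpen_ball.mem_nhds (by simp),
      (hL2 _ (by positivity)).integrable_sq⟩
  · intro φ hφ hc i
    rw [aux_grad volume hul hg'm hgl hkey hφ hc]
    congr 1
    refine integral_congr_ae ?_
    filter_upwards [hg'] with x hx
    rw [hx]
    simp [EuclideanSpace.inner_single_right]
end
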